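/- Let Φ : ℝ³ → ℝ³ be twice continuously differentiable with DΦ(x) invertible for every x, and let w : ℝ³ → ℝ³ be continuously differentiable. Define the pullback vector field (Φ*w)(x) = (DΦ(x))ᵀ w(Φ(x)). Then for every x ∈ ℝ³, ∇×(Φ*w)(x) = det(DΦ(x)) · (DΦ(x))⁻¹ ((∇×w)(Φ(x))). -/

import Mathlib

open Matrix

/-- Partial derivative in the `j`-th coordinate direction of a scalar function on `ℝ³`. -/
noncomputable def pd (j : Fin 3) (f : (Fin 3 → ℝ) → ℝ) (x : Fin 3 → ℝ) : ℝ :=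
  fderiv ℝ f x (Pi.single j 1)

/-- Curl of a vector field on `ℝ³`. -/
noncomputable def curl (v : (Fin 3 → ℝ) → (Fin 3 → ℝ)) (x : Fin 3 → ℝ) : Fin 3 → ℝ :=
  ![pd 1 (fun y => v y 2) x - pd 2 (fun y => v y 1) x,
    pd 2 (fun y => v y 0) x - pd 0 (fun y => v y 2) x,
    pd 0 (fun y => v y 1) x - pd 1 (fun y => v y 0) x]

/-- Jacobian matrix of a map `Φ : ℝ³ → ℝ³`. -/
noncomputable def jac (Φ : (Fin 3 → ℝ) → (Fin 3 → ℝ)) (x : Fin 3 → ℝ) :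
    Matrix (Fin 3) (Fin 3) ℝ :=
  fun i j => pd j (fun y => Φ y i) x

/-- Chain rule for partial derivatives. -/
theorem pd_comp {f : (Fin 3 → ℝ) → ℝ} {Φ : (Fin 3 → ℝ) → (Fin 3 → ℝ)} {x : Fin 3 → ℝ}
    (hf : DifferentiableAt ℝ f (Φ x)) (hΦ : DifferentiableAt ℝ Φ x) (j : Fin 3) :
    pd j (fun y => f (Φ y)) x = ∑ i, pd i f (Φ x) * jac Φ x i j := by
  have hcoord : ∀ i, jac Φ x i j = fderiv ℝ Φ x (Pi.single j 1) i := fun i => by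
    simp only [jac, pd, fderiv_apply hΦ]
    rfl
  simp only [hcoord, pd]
  rw [show (fun y => f (Φ y)) = f ∘ Φ from rfl, fderiv_comp x hf hΦ,
    ContinuousLinearMap.comp_apply]
  conv_lhs => rw [pi_eq_sum_univ' (fderiv ℝ Φ x (Pi.single j 1)), map_sum]
  refine Finset.sum_congr rfl fun i _ => ?_
  rw [map_smul, smul_eq_mul, mul_comm]

/-- Leibniz rule for partial derivatives. -/
theorem pd_sum_mul {ι : Type*} [Fintype ι] {f g : ι → (Fin 3 → ℝ) → ℝ} {x : Fin 3 → ℝ}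
    (hf : ∀ i, DifferentiableAt ℝ (f i) x) (hg : ∀ i, DifferentiableAt ℝ (g i) x) (j : Fin 3) :
    pd j (fun y => ∑ i, f i y * g i y) x = ∑ i, (pd j (f i) x * g i x + f i x * pd j (g i) x) := by
  unfold pd
  rw [fderiv_fun_sum fun i _ => (hf i).fun_mul (hg i), _root_.sum_apply]
  refine Finset.sum_congr rfl fun i _ => ?_
  rw [fderiv_fun_mul (hf i) (hg i)]
  simp
  ring

/-- Partial derivatives of a `C²` function are differentiable. -/
theorem differentiable_pd {f : (Fin 3 → ℝ) → ℝ} (hf : ContDiff ℝ 2 f) (j : Fin 3) :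
    Differentiable ℝ (pd j f) := by
  have h : Differentiable ℝ (fderiv ℝ f) :=
    (hf.fderiv_right (m := 1) (by norm_num)).differentiable (by norm_num)
  exact h.clm_apply (differentiable_const _)

/-- Symmetry of second partial derivatives of a `C²` function. -/
theorem pd_comm {f : (Fin 3 → ℝ) → ℝ} (hf : ContDiff ℝ 2 f) (j k : Fin 3) (x : Fin 3 → ℝ) :
    pd j (pd k f) x = pd k (pd j f) x := by
  have h : DifferentiableAt ℝ (fderiv ℝ f) x :=
    (hf.fderiv_right (m := 1) (by norm_num)).differentiable (by norm_num) x
  have hpd : ∀ a b, pd a (pd b f) x = fderiv ℝ (fderiv ℝ f) x (Pi.single a 1) (Pi.single b 1) := by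
    intro a b
    change fderiv ℝ (fun y => fderiv ℝ f y (Pi.single b 1)) x (Pi.single a 1) = _
    rw [fderiv_clm_apply h (differentiableAt_const _)]
    simp
  rw [hpd, hpd]
  exact (hf.contDiffAt.isSymmSndFDerivAt (by simp)).eq _ _

/-- Partial derivatives of the components of the pullback `(DΦ)ᵀ (w ∘ Φ)`. -/
theorem pd_pullback {Φ w : (Fin 3 → ℝ) → (Fin 3 → ℝ)} (hΦ : ContDiff ℝ 2 Φ)
    (hw : Differentiable ℝ w) (j k : Fin 3) (x : Fin 3 → ℝ) :
    pd j (fun y => (jac Φ y)ᵀ.mulVec (w (Φ y)) k) x =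
      ∑ i, (pd j (pd k fun y => Φ y i) x * w (Φ x) i +
        jac Φ x i k * ∑ l, jac w (Φ x) i l * jac Φ x l j) := by
  have hΦd : Differentiable ℝ Φ := hΦ.differentiable (by norm_num)
  have hwi : ∀ i, Differentiable ℝ fun z => w z i := differentiable_pi.1 hw
  refine (pd_sum_mul (f := fun i => pd k fun y => Φ y i) (g := fun i y => w (Φ y) i)
    (fun i => differentiable_pd (contDiff_pi.1 hΦ i) k x)
    (fun i => ((hwi i).comp hΦd) x) j).trans ?_
  refine Finset.sum_congr rfl fun i _ => ?_
  rw [pd_comp (hwi i (Φ x)) (hΦd x) j]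
  rfl

/-- For `Φ : ℝ³ → ℝ³` of class `C²` with invertible Jacobian and `w` of class `C¹`, the
pullback `(Φ*w)(x) = (DΦ(x))ᵀ w(Φ(x))` satisfies
`∇×(Φ*w)(x) = det(DΦ(x)) · (DΦ(x))⁻¹ ((∇×w)(Φ(x)))`. -/
theorem curl_pullback_three_dim
    (Φ : (Fin 3 → ℝ) → (Fin 3 → ℝ)) (hΦ : ContDiff ℝ 2 Φ)
    (hinv : ∀ x : Fin 3 → ℝ, IsUnit (jac Φ x).det)
    (w : (Fin 3 → ℝ) → (Fin 3 → ℝ)) (hw : ContDiff ℝ 1 w) :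
    ∀ x : Fin 3 → ℝ,
      curl (fun y => (jac Φ y)ᵀ.mulVec (w (Φ y))) x
        = (jac Φ x).det • (jac Φ x)⁻¹.mulVec (curl w (Φ x)) := by
  intro x
  have hadj : (jac Φ x).det • (jac Φ x)⁻¹ = (jac Φ x).adjugate := by
    rw [inv_def, smul_smul, Ring.mul_inverse_cancel _ (hinv x), one_smul]
  have hcomm := fun i j k => pd_comm (contDiff_pi.1 hΦ i) j k x
  have hcurl : ∀ z, curl w z = ![jac w z 2 1 - jac w z 1 2, jac w z 0 2 - jac w z 2 0,
      jac w z 1 0 - jac w z 0 1] := fun _ => rfl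
  rw [← smul_mulVec, hadj, hcurl, adjugate_fin_three]
  unfold curl
  simp only [pd_pullback hΦ (hw.differentiable one_ne_zero)]
  ext a
  fin_cases a <;>
    simp [Fin.sum_univ_three, mulVec, dotProduct, hcomm _ 1 0, hcomm _ 2 0, hcomm _ 2 1] <;>
    ring
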